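/- Let a > 1, let w : [a,∞) → (0,∞) be continuous and increasing, let C > 0, let ψ(t) = C·∫_a^t (w(u)/u) du for t ≥ a, assume ψ is unbounded and that γ(t) = ∫_t^∞ w(u)/u² du is finite for all t ≥ a, and for each integer k ≥ 1 let ε_k > 0 be the solution of ψ(1/ε_k) = k. Then there exists A > 0 such that for every z ∈ ℂ with |Im z| ≥ 1 and 2|z| ≥ a, the product ∏_{k≥1} cos(ε_k·z) converges and log|∏_{k≥1} cos(ε_k·z)| ≥ −A·( |z|·γ(2|z|) + ψ(2|z|)·log(2|z|) ). -/

import Mathlib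

open MeasureTheory

noncomputable section

lemma Complex.norm_cos_sq (z : ℂ) :
    ‖Complex.cos z‖ ^ 2 = Real.cos z.re ^ 2 + Real.sinh z.im ^ 2 := by
  rw [Complex.sq_norm, Complex.normSq_apply, Complex.cos_eq z]
  simp only [← Complex.ofReal_cos, ← Complex.ofReal_sin, ← Complex.ofReal_cosh,
    ← Complex.ofReal_sinh, ← Complex.ofReal_mul, Complex.sub_re, Complex.sub_im,
    Complex.mul_re, Complex.mul_im, Complex.I_re, Complex.I_im, Complex.ofReal_re, Complex.ofReal_im]
  linear_combination Real.cos z.re ^ 2 * Real.cosh_sq z.im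
    + Real.sinh z.im ^ 2 * Real.sin_sq_add_cos_sq z.re

lemma Complex.abs_im_le_norm_cos (z : ℂ) : |z.im| ≤ ‖Complex.cos z‖ := by
  have h : |z.im| ≤ |Real.sinh z.im| := by
    rw [Real.abs_sinh]
    exact Real.self_le_sinh_iff.2 (abs_nonneg _)
  refine h.trans (abs_le_of_sq_le_sq ?_ (norm_nonneg _))
  nlinarith [Complex.norm_cos_sq z, sq_nonneg (Real.cos z.re)]

lemma Complex.exp_neg_norm_le_norm_cos {z : ℂ} (hz : ‖z‖ ≤ 1 / 2) :
    Real.exp (-‖z‖) ≤ ‖Complex.cos z‖ := by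
  have h1 : Real.cos z.re ≤ ‖Complex.cos z‖ := by
    refine (le_abs_self _).trans (abs_le_of_sq_le_sq ?_ (norm_nonneg _))
    nlinarith [Complex.norm_cos_sq z, sq_nonneg (Real.sinh z.im)]
  have h2 := Real.one_sub_sq_div_two_le_cos (x := z.re)
  have h3 : z.re ^ 2 ≤ ‖z‖ ^ 2 := sq_le_sq' (abs_le.1 (Complex.abs_re_le_norm z)).1
    (abs_le.1 (Complex.abs_re_le_norm z)).2
  have h0 := norm_nonneg z
  have h4 : Real.exp (-‖z‖) * (1 + ‖z‖) ≤ 1 := by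
    calc _ ≤ Real.exp (-‖z‖) * Real.exp ‖z‖ := by
          gcongr
          linarith [Real.add_one_le_exp ‖z‖]
      _ = 1 := by rw [← Real.exp_add]; simp
  have h5 : (1 : ℝ) ≤ (1 - ‖z‖ ^ 2 / 2) * (1 + ‖z‖) := by nlinarith [mul_nonneg h0 h0]
  have h6 : Real.exp (-‖z‖) ≤ 1 - ‖z‖ ^ 2 / 2 :=
    le_of_mul_le_mul_right (h4.trans h5) (by linarith)
  linarith

lemma Complex.multipliable_cos_mul {ε : ℕ → ℝ} (hε : Summable ε) (z : ℂ) :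
    Multipliable (fun k : ℕ => Complex.cos ((ε k : ℂ) * z)) := by
  have hO : (fun x : ℂ => Complex.cos x - 1) =O[nhds 0] fun x => x := by
    simpa using (Complex.hasDerivAt_cos 0).isBigO_sub
  have hlim : Filter.Tendsto (fun k : ℕ => (ε k : ℂ) * z) Filter.atTop (nhds 0) := by
    have h := (Complex.continuous_ofReal.tendsto 0).comp hε.tendsto_atTop_zero
    simpa using h.mul_const z
  have hsum : Summable fun k : ℕ => ‖Complex.cos ((ε k : ℂ) * z) - 1‖ := by
    refine summable_of_isBigO_nat (g := fun k => ‖(ε k : ℂ) * z‖) ?_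
      (hO.comp_tendsto hlim).norm_norm
    simpa using hε.abs.mul_right ‖z‖
  simpa using multipliable_one_add_of_summable hsum

lemma inv_le_integral_div_sq {w : ℝ → ℝ} {x y C : ℝ} (hC : 0 < C) (hx : 0 < x) (hxy : x ≤ y)
    (hpos : ∀ u ∈ Set.Icc x y, 0 ≤ w u) (hcont : ContinuousOn w (Set.Icc x y))
    (h : C * ∫ u in x..y, w u / u = 1) :
    1 / y ≤ C * ∫ u in x..y, w u / u ^ 2 := by
  have hne : ∀ u ∈ Set.Icc x y, u ≠ 0 := fun u hu => (hx.trans_le hu.1).ne'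
  have hmono : ∫ u in x..y, (w u / u) * (1 / y) ≤ ∫ u in x..y, w u / u ^ 2 := by
    refine intervalIntegral.integral_mono_on hxy ?_ ?_ ?_
    · refine ContinuousOn.intervalIntegrable_of_Icc hxy ?_
      exact (hcont.div continuousOn_id hne).mul continuousOn_const
    · refine ContinuousOn.intervalIntegrable_of_Icc hxy ?_
      exact hcont.div (continuousOn_id.pow 2) fun u hu => pow_ne_zero 2 (hne u hu)
    · intro u hu
      have hu0 : 0 < u := hx.trans_le hu.1
      have hw := hpos u hu
      calc w u / u * (1 / y) ≤ w u / u * (1 / u) := by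
            gcongr
            exact hu.2
        _ = w u / u ^ 2 := by field_simp
  rw [intervalIntegral.integral_mul_const] at hmono
  calc 1 / y = C * ((∫ u in x..y, w u / u) * (1 / y)) := by rw [← mul_assoc, h, one_mul]
    _ ≤ _ := by gcongr

lemma sum_inv_le_integral_Ioi {w : ℝ → ℝ} {s : ℕ → ℝ} {t C : ℝ} (hC : 0 < C) (ht : 0 < t)
    (hs : Monotone s) (hts : t ≤ s 0)
    (hpos : ∀ u ≥ t, 0 ≤ w u) (hcont : ContinuousOn w (Set.Ici t))
    (hint : IntegrableOn (fun u => w u / u ^ 2) (Set.Ioi t))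
    (h : ∀ n, C * ∫ u in s n..s (n + 1), w u / u = 1) (n : ℕ) :
    ∑ i ∈ Finset.range n, 1 / s i ≤ 1 / t + C * ∫ u in Set.Ioi t, w u / u ^ 2 := by
  have hst : ∀ i, t ≤ s i := fun i => hts.trans (hs i.zero_le)
  have hcont' : ContinuousOn (fun u => w u / u ^ 2) (Set.Ici t) :=
    hcont.div (continuousOn_id.pow 2) fun u hu => pow_ne_zero 2 (ht.trans_le hu).ne'
  have hii : ∀ x y, t ≤ x → t ≤ y →
      IntervalIntegrable (fun u => w u / u ^ 2) volume x y := fun x y hx hy =>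
    (hcont'.mono fun u hu => (le_min hx hy).trans hu.1).intervalIntegrable
  have key : ∀ n, ∑ i ∈ Finset.range (n + 1), 1 / s i
      ≤ 1 / t + C * ∫ u in s 0..s n, w u / u ^ 2 := by
    intro n
    induction n with
    | zero =>
      simpa using inv_anti₀ ht hts
    | succ n ih =>
      rw [Finset.sum_range_succ, ← intervalIntegral.integral_add_adjacent_intervals
        (hii _ _ (hst 0) (hst n)) (hii _ _ (hst n) (hst (n + 1)))]
      have := inv_le_integral_div_sq hC (ht.trans_le (hst n)) (hs n.le_succ)
        (fun u hu => hpos u ((hst n).trans hu.1))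
        (hcont.mono fun u hu => (hst n).trans hu.1) (h n)
      linarith
  have hsn : 0 ≤ 1 / s n := one_div_nonneg.2 (ht.le.trans (hst n))
  have hle : ∫ u in s 0..s n, w u / u ^ 2 ≤ ∫ u in Set.Ioi t, w u / u ^ 2 := by
    rw [intervalIntegral.integral_of_le (hs n.zero_le)]
    refine setIntegral_mono_set hint ?_ ?_
    · filter_upwards [ae_restrict_mem measurableSet_Ioi] with u hu
      exact div_nonneg (hpos u (le_of_lt hu)) (sq_nonneg u)
    · exact Filter.Eventually.of_forall fun u hu => hts.trans_lt hu.1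
  have h1 := key n
  rw [Finset.sum_range_succ] at h1
  have h2 := mul_le_mul_of_nonneg_left hle hC.le
  linarith

lemma div_le_integral_Ioi_div_sq {w : ℝ → ℝ} {t c : ℝ} (ht : 0 < t) (hc : ∀ u ≥ t, c ≤ w u)
    (hint : IntegrableOn (fun u => w u / u ^ 2) (Set.Ioi t)) :
    c / t ≤ ∫ u in Set.Ioi t, w u / u ^ 2 := by
  have h1 : IntegrableOn (fun u : ℝ => u ^ (-2 : ℝ)) (Set.Ioi t) :=
    integrableOn_Ioi_rpow_of_lt (by norm_num) ht
  have h2 : ∫ u in Set.Ioi t, c * u ^ (-2 : ℝ) = c / t := by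
    rw [integral_const_mul, integral_Ioi_rpow_of_lt (by norm_num) ht]
    norm_num [Real.rpow_neg_one, div_eq_mul_inv]
  rw [← h2]
  refine setIntegral_mono_on (h1.const_mul c) hint measurableSet_Ioi fun u hu => ?_
  have hu0 : 0 < u := ht.trans hu
  rw [Real.rpow_neg hu0.le, ← div_eq_mul_inv, Real.rpow_two]
  gcongr
  exact hc u (le_of_lt hu)

lemma le_norm_tprod_of_le_norm_prod {f : ℕ → ℂ} (hf : Multipliable f) {c : ℝ} (N : ℕ)
    (h : ∀ n, c ≤ ‖∏ k ∈ Finset.range (N + n), f k‖) : c ≤ ‖∏' k, f k‖ := by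
  refine ge_of_tendsto hf.hasProd.tendsto_prod_nat.norm ?_
  filter_upwards [Filter.eventually_ge_atTop N] with n hn
  obtain ⟨m, rfl⟩ := Nat.exists_eq_add_of_le hn
  exact h m

/-- cosine-product lemma. For `|Im z| ≥ 1` and `2|z| ≥ a`, the product
`∏ cos(ε_k z)` converges and
`log |∏ cos(ε_k z)| ≥ -A (|z| γ(2|z|) + ψ(2|z|) log(2|z|))`. -/
theorem cos_product_lower_bound (a : ℝ) (ha : 1 < a) (w : ℝ → ℝ)
    (hwpos : ∀ u ≥ a, 0 < w u) (hwcont : ContinuousOn w (Set.Ici a))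
    (hwmono : MonotoneOn w (Set.Ici a))
    (C : ℝ) (hC : 0 < C)
    (ψ : ℝ → ℝ) (hψ : ∀ t ≥ a, ψ t = C * ∫ u in a..t, w u / u)
    (hψunb : ∀ M : ℝ, ∃ t ≥ a, M < ψ t)
    (γ : ℝ → ℝ)
    (hγint : ∀ t ≥ a, MeasureTheory.IntegrableOn (fun u => w u / u ^ 2) (Set.Ioi t))
    (hγ : ∀ t ≥ a, γ t = ∫ u in Set.Ioi t, w u / u ^ 2)
    (ε : ℕ → ℝ)
    (hε : ∀ k : ℕ, 0 < ε k ∧ a ≤ 1 / ε k ∧ ψ (1 / ε k) = (k : ℝ) + 1) :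
    ∃ A > (0 : ℝ), ∀ z : ℂ, 1 ≤ |z.im| → a ≤ 2 * ‖z‖ →
      Multipliable (fun k : ℕ => Complex.cos ((ε k : ℂ) * z)) ∧
      -A * (‖z‖ * γ (2 * ‖z‖) + ψ (2 * ‖z‖) * Real.log (2 * ‖z‖)) ≤
        Real.log ‖∏' k : ℕ, Complex.cos ((ε k : ℂ) * z)‖ := by
  have ha0 : 0 < a := by linarith
  have hwa := hwpos a le_rfl
  have hii : ∀ x y, a ≤ x → a ≤ y →
      IntervalIntegrable (fun u => w u / u) volume x y := fun x y hx hy =>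
    ((hwcont.div continuousOn_id fun u hu => (ha0.trans_le hu).ne').mono
      fun u hu => (le_min hx hy).trans hu.1).intervalIntegrable
  have hψsub : ∀ x y, a ≤ x → a ≤ y → C * ∫ u in x..y, w u / u = ψ y - ψ x := by
    intro x y hx hy
    rw [hψ x hx, hψ y hy, ← intervalIntegral.integral_add_adjacent_intervals
      (hii a x le_rfl hx) (hii x y hx hy)]
    ring
  have hψmono : ∀ x y, a ≤ x → x ≤ y → ψ x ≤ ψ y := by
    intro x y hx hxy
    rw [← sub_nonneg, ← hψsub x y hx (hx.trans hxy)]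
    refine mul_nonneg hC.le (intervalIntegral.integral_nonneg hxy fun u hu => ?_)
    exact div_nonneg (hwpos u (hx.trans hu.1)).le (ha0.le.trans (hx.trans hu.1))
  have hψa : ψ a = 0 := by simp [hψ a le_rfl]
  have hlt : ∀ (k : ℕ) (t : ℝ), a ≤ t → ψ t < k + 1 → t < 1 / ε k := by
    intro k t ht hk
    by_contra! hcon
    linarith [hψmono _ _ (hε k).2.1 hcon, (hε k).2.2]
  have hs : Monotone fun k => 1 / ε k := by
    refine monotone_nat_of_le_succ fun k => (hlt (k + 1) _ (hε k).2.1 ?_).le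
    rw [(hε k).2.2]
    push_cast
    linarith
  have hstep : ∀ k, C * ∫ u in 1 / ε k..1 / ε (k + 1), w u / u = 1 := by
    intro k
    rw [hψsub _ _ (hε k).2.1 (hε (k + 1)).2.1, (hε k).2.2, (hε (k + 1)).2.2]
    push_cast
    ring
  have htail : ∀ t N n, a ≤ t → t ≤ 1 / ε N →
      ∑ i ∈ Finset.range n, ε (N + i) ≤ 1 / t + C * γ t := by
    intro t N n ht htN
    have := sum_inv_le_integral_Ioi (s := fun i => 1 / ε (N + i)) hC (ha0.trans_le ht)
      (fun i j hij => hs (by omega)) htN (fun u hu => (hwpos u (ht.trans hu)).le)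
      (hwcont.mono (Set.Ici_subset_Ici.2 ht)) (hγint t ht) (fun i => hstep (N + i)) n
    simpa only [one_div_one_div, hγ t ht] using this
  have hsum : Summable ε := by
    refine summable_of_sum_range_le (c := 1 / a + C * γ a) (fun k => (hε k).1.le) fun n => ?_
    simpa only [Nat.zero_add] using htail a 0 n le_rfl (hε 0).2.1
  refine ⟨1 + C + 1 / w a, by positivity, fun z hz hza => ?_⟩
  have hmul := Complex.multipliable_cos_mul hsum z
  refine ⟨hmul, ?_⟩
  obtain ⟨t, ht⟩ : ∃ t, t = 2 * ‖z‖ := ⟨_, rfl⟩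
  rw [← ht] at hza ⊢
  have ht0 : 0 < t := ha0.trans_le hza
  have hlog : 0 ≤ Real.log t := Real.log_nonneg (by linarith)
  have hψt : 0 ≤ ψ t := hψa ▸ hψmono a t le_rfl hza
  have hex : ∃ k, t ≤ 1 / ε k := by
    obtain ⟨k, hk⟩ := exists_nat_gt (ψ t)
    exact ⟨k, (hlt k t hza (by linarith)).le⟩
  obtain ⟨N, hN, hNmin⟩ : ∃ N, t ≤ 1 / ε N ∧ ∀ k < N, 1 / ε k < t := by
    classical
    exact ⟨Nat.find hex, Nat.find_spec hex, fun k hk => not_le.1 (Nat.find_min hex hk)⟩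
  have hNψ : (N : ℝ) ≤ ψ t := by
    cases N with
    | zero => simpa using hψt
    | succ m =>
      have := hψmono _ _ (hε m).2.1 (hNmin m m.lt_succ_self).le
      rw [(hε m).2.2] at this
      exact_mod_cast this
  have hbig : ∀ k < N, Real.exp (-Real.log t) ≤ ‖Complex.cos ((ε k : ℂ) * z)‖ := by
    intro k hk
    refine le_trans ?_ (Complex.abs_im_le_norm_cos _)
    have hεk := (hε k).1
    rw [Real.exp_neg, Real.exp_log ht0, Complex.im_ofReal_mul, abs_mul, abs_of_pos hεk,
      ← one_div]
    calc 1 / t ≤ ε k := (one_div_lt ht0 hεk).2 (hNmin k hk) |>.le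
      _ ≤ ε k * |z.im| := le_mul_of_one_le_right hεk.le hz
  have hsmall : ∀ i, Real.exp (-(ε (N + i) * ‖z‖)) ≤
      ‖Complex.cos ((ε (N + i) : ℂ) * z)‖ := by
    intro i
    have hεk := (hε (N + i)).1
    have hn : ‖(ε (N + i) : ℂ) * z‖ = ε (N + i) * ‖z‖ := by
      rw [norm_mul, Complex.norm_of_nonneg hεk.le]
    have hle : t ≤ 1 / ε (N + i) := hN.trans (hs (N.le_add_right i))
    rw [le_div_iff₀ hεk] at hle
    rw [← hn]
    apply Complex.exp_neg_norm_le_norm_cos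
    rw [hn]
    nlinarith
  have hprod : ∀ n, Real.exp (-(N * Real.log t + (1 / t + C * γ t) * ‖z‖)) ≤
      ‖∏ k ∈ Finset.range (N + n), Complex.cos ((ε k : ℂ) * z)‖ := by
    intro n
    rw [Finset.prod_range_add, norm_mul, norm_prod, norm_prod, neg_add, Real.exp_add]
    gcongr
    · calc Real.exp (-(N * Real.log t))
          = ∏ k ∈ Finset.range N, Real.exp (-Real.log t) := by
            rw [← Real.exp_sum]
            simp
        _ ≤ _ := Finset.prod_le_prod (fun _ _ => (Real.exp_pos _).le)
            fun k hk => hbig k (Finset.mem_range.1 hk)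
    · calc Real.exp (-((1 / t + C * γ t) * ‖z‖))
          ≤ Real.exp (-((∑ i ∈ Finset.range n, ε (N + i)) * ‖z‖)) := by
            gcongr
            exact htail t N n hza hN
        _ = ∏ i ∈ Finset.range n, Real.exp (-(ε (N + i) * ‖z‖)) := by
            rw [← Real.exp_sum, Finset.sum_neg_distrib, Finset.sum_mul]
        _ ≤ _ := Finset.prod_le_prod (fun _ _ => (Real.exp_pos _).le) fun i _ => hsmall i
  have hfin := le_norm_tprod_of_le_norm_prod hmul N hprod
  have hlogfin := (Real.le_log_iff_exp_le ((Real.exp_pos _).trans_le hfin)).2 hfin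
  refine le_trans ?_ hlogfin
  have hγlow : w a / t ≤ γ t := by
    rw [hγ t hza]
    exact div_le_integral_Ioi_div_sq ht0
      (fun u hu => hwmono Set.self_mem_Ici (hza.trans hu) (hza.trans hu)) (hγint t hza)
  have h1 : 1 / t ≤ 1 / w a * γ t := by
    calc 1 / t = 1 / w a * (w a / t) := by field_simp
      _ ≤ _ := by gcongr
  have hγ0 : 0 ≤ γ t := le_trans (by positivity) hγlow
  have h2 : (1 / t + C * γ t) * ‖z‖ ≤ (1 / w a * γ t + C * γ t) * ‖z‖ := by gcongr
  have h3 : N * Real.log t ≤ ψ t * Real.log t := by gcongr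
  have h4 : 0 ≤ (C + 1 / w a) * (ψ t * Real.log t) := by positivity
  have h5 : 0 ≤ ‖z‖ * γ t := by positivity
  linarith
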